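/- Let Γ be a finite connected graph on vertex set V that is both vertex-transitive and edge-transitive (i.e., Aut(Γ) acts transitively on V and on the edge set E). Then for every integer n with 2 ≤ n ≤ |V| − 1, one has h_{n+1}(Γ) ≤ (10n + 1)·h_n(Γ). -/

import Mathlib

open scoped Pointwise

namespace Multiway

variable {V : Type*}

/-- The edge boundary `∂A`: the set of edges with one endpoint in `A` and the other in `Vᶜ∖A`. -/
def edgeBdry (G : SimpleGraph V) (A : Set V) : Set (Sym2 V) :=
  {e | e ∈ G.edgeSet ∧ ∃ u v, e = s(u, v) ∧ u ∈ A ∧ v ∉ A}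

/-- The symmetric vertex boundary `δA`: vertices incident to an edge crossing `A`. -/
def vertBdry (G : SimpleGraph V) (A : Set V) : Set V :=
  {x | ∃ y, G.Adj x y ∧ ¬ (x ∈ A ↔ y ∈ A)}

/-- A partition of the vertex set into `n` non-empty pairwise disjoint sets. -/
def IsNPartition (n : ℕ) (A : Fin n → Set V) : Prop :=
  (∀ i, (A i).Nonempty) ∧ (∀ i j, i ≠ j → Disjoint (A i) (A j)) ∧ (⋃ i, A i) = Set.univ

/-- `max_i |∂A_i| / |A_i|`. -/
noncomputable def edgeRatioMax (G : SimpleGraph V) {n : ℕ} (A : Fin n → Set V) : ℝ :=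
  ⨆ i, ((edgeBdry G (A i)).ncard : ℝ) / ((A i).ncard : ℝ)

/-- `max_i |δA_i| / |A_i|`. -/
noncomputable def vertRatioMax (G : SimpleGraph V) {n : ℕ} (A : Fin n → Set V) : ℝ :=
  ⨆ i, ((vertBdry G (A i)).ncard : ℝ) / ((A i).ncard : ℝ)

/-- The `n`-way isoperimetric constant `h_n(Γ)`. -/
noncomputable def multiH (G : SimpleGraph V) (n : ℕ) : ℝ :=
  sInf {r | ∃ A : Fin n → Set V, IsNPartition n A ∧ r = edgeRatioMax G A}

/-- The `n`-way symmetric vertex isoperimetric constant `ι_n(Γ)`. -/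
noncomputable def multiIota (G : SimpleGraph V) (n : ℕ) : ℝ :=
  sInf {r | ∃ A : Fin n → Set V, IsNPartition n A ∧ r = vertRatioMax G A}

/-- A graph is vertex-transitive if its automorphism group acts transitively on vertices. -/
def VertexTransitive (G : SimpleGraph V) : Prop :=
  ∀ u v : V, ∃ φ : G ≃g G, φ u = v


/-- A graph is edge-transitive if its automorphism group acts transitively on edges. -/
def EdgeTransitive (G : SimpleGraph V) : Prop :=
  ∀ e ∈ G.edgeSet, ∀ e' ∈ G.edgeSet, ∃ φ : G ≃g G, Sym2.map ⇑φ e = e'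

section core
open Finset Classical

variable [Fintype V] (G : SimpleGraph V)

noncomputable instance autFintype : Fintype (G ≃g G) :=
  Fintype.ofInjective (fun φ : G ≃g G => (φ : V → V)) DFunLike.coe_injective

/-- pull-back of `B` by `φ` -/
noncomputable def pb {G : SimpleGraph V} (B : Finset V) (φ : G ≃g G) : Finset V :=
  univ.filter (fun x => φ x ∈ B)

lemma mem_pb {G : SimpleGraph V} (B : Finset V) (φ : G ≃g G) (x : V) :
    x ∈ pb B φ ↔ φ x ∈ B := by simp [pb]

lemma card_pb {G : SimpleGraph V} (B : Finset V) (φ : G ≃g G) : #(pb B φ) = #B := by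
  apply Finset.card_bij (fun x _ => φ x)
  · intro x hx; exact (mem_pb B φ x).1 hx
  · intro x _ y _ h; exact φ.injective h
  · intro y hy
    exact ⟨φ.symm y, by simpa [mem_pb] using hy, by simp⟩

/-- ordered boundary pairs -/
noncomputable def bd (B : Finset V) : Finset (V × V) :=
  univ.filter (fun p => G.Adj p.1 p.2 ∧ p.1 ∈ B ∧ p.2 ∉ B)

lemma card_bd_pb (B : Finset V) (φ : G ≃g G) : #(bd G (pb B φ)) = #(bd G B) := by
  apply Finset.card_bij (fun p _ => (φ p.1, φ p.2))
  · rintro ⟨x, y⟩ hx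
    simpa [bd, mem_pb, φ.map_adj_iff] using hx
  · rintro ⟨x, y⟩ _ ⟨z, w⟩ _ h
    simpa using h
  · rintro ⟨x, y⟩ hy
    refine ⟨(φ.symm x, φ.symm y), ?_, by simp⟩
    simpa [bd, mem_pb, φ.symm.map_adj_iff] using hy

lemma count_comp (P : (G ≃g G) → Prop) [DecidablePred P] (ψ : G ≃g G) :
    #(univ.filter (fun φ : G ≃g G => P (ψ.trans φ))) = #(univ.filter P) := by
  apply Finset.card_bij (fun φ _ => ψ.trans φ)
  · intro φ h; simpa using h
  · intro φ _ φ' _ h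
    ext x
    have := congrArg (fun f : G ≃g G => f (ψ.symm x)) h
    simpa using this
  · intro φ h
    have e : ψ.trans (ψ.symm.trans φ) = φ := by ext x; simp
    refine ⟨ψ.symm.trans φ, ?_, e⟩
    simpa [e] using h

/-- count of `φ` with `φ x ∈ B` -/
noncomputable def kk (B : Finset V) (x : V) : ℕ := #(univ.filter (fun φ : G ≃g G => φ x ∈ B))

lemma kk_const (hvt : VertexTransitive G) (B : Finset V) (x y : V) : kk G B x = kk G B y := by
  obtain ⟨ψ, h⟩ := hvt y x
  rw [kk, kk, ← count_comp G (fun φ => φ y ∈ B) ψ]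
  simp [h]

lemma kk_mul (hvt : VertexTransitive G) (B : Finset V) (x : V) :
    Fintype.card V * kk G B x = Fintype.card (G ≃g G) * #B := by
  have h1 : ∑ y : V, kk G B y = Fintype.card V * kk G B x := by
    rw [Finset.sum_congr rfl (fun y _ => kk_const G hvt B y x)]; simp
  have h2 : ∑ y : V, kk G B y = ∑ φ : G ≃g G, #(pb B φ) := by
    simp only [kk, pb, Finset.card_filter]
    rw [Finset.sum_comm]
  rw [← h1, h2, Finset.sum_congr rfl (fun φ _ => card_pb B φ)]; simp

noncomputable def tt (B : Finset V) (x y : V) : ℕ :=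
  #(univ.filter (fun φ : G ≃g G => φ x ∈ B ∧ φ y ∉ B))

lemma tt_add (B : Finset V) (x y : V) :
    tt G B x y + #(univ.filter (fun φ : G ≃g G => φ x ∈ B ∧ φ y ∈ B)) = kk G B x := by
  rw [tt, kk, add_comm, ← Finset.card_filter_add_card_filter_not (s := univ.filter (fun φ : G ≃g G => φ x ∈ B)) (fun φ => φ y ∈ B)]
  simp [Finset.filter_filter]

lemma tt_symm (hvt : VertexTransitive G) (B : Finset V) (x y : V) : tt G B x y = tt G B y x := by
  have h1 := tt_add G B x y
  have h2 := tt_add G B y x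
  have h3 := kk_const G hvt B x y
  have h4 : (univ.filter (fun φ : G ≃g G => φ x ∈ B ∧ φ y ∈ B)) =
    (univ.filter (fun φ : G ≃g G => φ y ∈ B ∧ φ x ∈ B)) := by
    ext; simp [and_comm]
  rw [h4] at h1
  omega

lemma tt_const (hvt : VertexTransitive G) (het : EdgeTransitive G) (B : Finset V) (x y z w : V)
    (h : G.Adj x y) (h' : G.Adj z w) : tt G B x y = tt G B z w := by
  obtain ⟨ψ, hψ⟩ := het s(z, w) h' s(x, y) h
  have key := count_comp G (fun φ => φ z ∈ B ∧ φ w ∉ B) ψ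
  simp only [Sym2.map_mk, Sym2.eq_iff] at hψ
  rcases hψ with ⟨h1, h2⟩ | ⟨h1, h2⟩
  · rw [tt, tt, ← key]; simp [h1, h2]
  · rw [tt_symm G hvt, tt, tt, ← key]; simp [h1, h2]

lemma tt_mul (hvt : VertexTransitive G) (het : EdgeTransitive G) (B : Finset V) (d : ℕ)
    (hd : ∀ x, G.degree x = d) (x y : V) (h : G.Adj x y) :
    Fintype.card V * d * tt G B x y = Fintype.card (G ≃g G) * #(bd G B) := by
  have h1 : ∑ p ∈ univ.filter (fun p : V × V => G.Adj p.1 p.2), tt G B p.1 p.2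
      = Fintype.card V * d * tt G B x y := by
    rw [Finset.sum_congr rfl (g := fun _ => tt G B x y)
      (fun p hp => tt_const G hvt het B _ _ _ _ (by simpa using hp) h)]
    have : #(univ.filter (fun p : V × V => G.Adj p.1 p.2)) = Fintype.card V * d := by
      rw [Finset.card_filter, Fintype.sum_prod_type]
      simp only [← Finset.card_filter]
      rw [Finset.sum_congr rfl (g := fun _ => d)]
      · simp
      · intro x _
        rw [← hd x, ← G.card_neighborFinset_eq_degree]
        congr 1; ext; simp
    rw [Finset.sum_const, this]; simp
  have h2 : ∑ p ∈ univ.filter (fun p : V × V => G.Adj p.1 p.2), tt G B p.1 p.2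
      = ∑ φ : G ≃g G, #(bd G (pb B φ)) := by
    simp only [tt, Finset.card_filter]
    rw [Finset.sum_comm]
    refine Finset.sum_congr rfl (fun φ _ => ?_)
    rw [← Finset.card_filter, Finset.filter_filter]
    simp [bd, mem_pb]
  rw [← h1, h2, Finset.sum_congr rfl (fun φ _ => card_bd_pb G B φ)]; simp

lemma core (hconn : G.Connected) (hvt : VertexTransitive G) (het : EdgeTransitive G)
    {n : ℕ} (A : Fin n → Finset V) (hdisj : ∀ i j, i ≠ j → Disjoint (A i) (A j))
    (hcov : ∀ x, ∃ i, x ∈ A i) (j : Fin n) (hmin : ∀ i, #(A j) ≤ #(A i)) (hne : 0 < #(A j))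
    (hhalf : 2 * #(A j) ≤ Fintype.card V) (d : ℕ) (hd0 : 0 < d) (hd : ∀ x, G.degree x = d)
    (hb : 21 * #(bd G (A j)) ≤ d * #(A j)) :
    ∃ φ : G ≃g G, ∀ i, 2 * #(A i) ≤ 21 * #(A i \ pb (A j) φ) := by
  by_contra hcon
  push Not at hcon
  choose I hI using hcon
  set B := A j with hB
  obtain ⟨v0⟩ := hconn.nonempty
  set N := Fintype.card V with hN
  have hNpos : 0 < N := Fintype.card_pos_iff.2 ⟨v0⟩
  set F := Fintype.card (G ≃g G) with hF
  have hFpos : 0 < F := Fintype.card_pos_iff.2 ⟨SimpleGraph.Iso.refl⟩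
  set k := kk G B v0 with hk
  have hkx : ∀ x, kk G B x = k := fun x => kk_const G hvt B x v0
  have hkm : N * k = F * #B := kk_mul G hvt B v0
  have hkpos : 0 < k := by
    rcases Nat.eq_zero_or_pos k with h | h
    · rw [h] at hkm
      have := Nat.mul_pos hFpos hne
      omega
    · exact h
  have ht : ∀ x y, G.Adj x y → 21 * tt G B x y ≤ k := by
    intro x y h
    have h1 := tt_mul G hvt het B d hd x y h
    have : (N * d) * (21 * tt G B x y) ≤ (N * d) * k := by
      calc (N * d) * (21 * tt G B x y) = 21 * (N * d * tt G B x y) := by ring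
        _ = F * (21 * #(bd G B)) := by rw [h1]; ring
        _ ≤ F * (d * #B) := Nat.mul_le_mul_left _ hb
        _ = d * (F * #B) := by ring
        _ = (N * d) * k := by rw [← hkm]; ring
    exact Nat.le_of_mul_le_mul_left this (Nat.mul_pos hNpos hd0)
  -- intersections
  have hint : ∀ φ, 19 * #(A (I φ)) ≤ 21 * #(A (I φ) ∩ pb B φ) := by
    intro φ
    have := hI φ
    have h2 := Finset.card_sdiff_add_card_inter (A (I φ)) (pb B φ)
    omega
  have hint2 : ∀ φ, 21 * #(pb B φ \ A (I φ)) ≤ 2 * #B := by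
    intro φ
    have h1 := hint φ
    have h2 := Finset.card_sdiff_add_card_inter (pb B φ) (A (I φ))
    rw [card_pb, Finset.inter_comm] at h2
    have h3 := hmin (I φ)
    omega
  have hR : ∀ φ φ', I φ = I φ' ↔ #B < 2 * #(pb B φ ∩ pb B φ') := by
    intro φ φ'
    constructor
    · intro h
      have h1 := hI φ
      have h2 := hI φ'
      rw [← h] at h2
      have h3 : A (I φ) ⊆ (A (I φ) \ pb B φ) ∪ (A (I φ) \ pb B φ') ∪ (pb B φ ∩ pb B φ') := by
        intro x hx
        simp only [Finset.mem_union, Finset.mem_sdiff, Finset.mem_inter]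
        tauto
      have h4 := Finset.card_le_card h3
      have h5 := Finset.card_union_le (A (I φ) \ pb B φ ∪ A (I φ) \ pb B φ') (pb B φ ∩ pb B φ')
      have h6 := Finset.card_union_le (A (I φ) \ pb B φ) (A (I φ) \ pb B φ')
      have h7 := hmin (I φ)
      omega
    · intro h
      by_contra hne'
      have h1 := hint2 φ
      have h2 := hint2 φ'
      have h3 : pb B φ ∩ pb B φ' ⊆ (pb B φ \ A (I φ)) ∪ (pb B φ' \ A (I φ')) := by
        intro x hx
        simp only [Finset.mem_union, Finset.mem_sdiff, Finset.mem_inter] at hx ⊢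
        have : x ∈ A (I φ) → x ∉ A (I φ') := fun hx1 => Finset.disjoint_left.1 (hdisj _ _ hne') hx1
        tauto
      have h4 := Finset.card_le_card h3
      have h5 := Finset.card_union_le (pb B φ \ A (I φ)) (pb B φ' \ A (I φ'))
      omega
  let Q : V → Fin n → ℕ := fun x i => #(univ.filter (fun φ : G ≃g G => φ x ∈ B ∧ I φ = i))
  have hQsum : ∀ x, ∑ i, Q x i = k := by
    intro x
    rw [← hkx x, kk, Finset.card_eq_sum_card_fiberwise (f := I) (t := univ) (by simp)]
    simp [Q, Finset.filter_filter]
  let C : V → ℕ := fun x => #(univ.filter (fun p : (G ≃g G) × (G ≃g G) =>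
    (p.1 x ∈ B ∧ p.2 x ∈ B) ∧ #B < 2 * #(pb B p.1 ∩ pb B p.2)))
  have hCQ : ∀ x, C x = ∑ i, Q x i * Q x i := by
    intro x
    simp only [C]
    rw [Finset.card_eq_sum_card_fiberwise (f := fun p => I p.1) (t := univ) (by simp)]
    refine Finset.sum_congr rfl (fun i _ => ?_)
    simp only [Q]
    rw [← Finset.card_product]
    congr 1
    ext ⟨φ, φ'⟩
    simp only [Finset.mem_filter, Finset.mem_univ, true_and, Finset.mem_product, ← hR]
    constructor
    · rintro ⟨⟨⟨a, b⟩, c⟩, e⟩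
      exact ⟨⟨a, e⟩, b, c ▸ e⟩
    · rintro ⟨⟨a, e⟩, b, c⟩
      exact ⟨⟨⟨a, b⟩, e.trans c.symm⟩, e⟩
  have hCconst : ∀ x y, C x = C y := by
    intro x y
    obtain ⟨ψ, hψ⟩ := hvt y x
    have hov : ∀ φ φ' : G ≃g G, #(pb B (ψ.trans φ) ∩ pb B (ψ.trans φ')) = #(pb B φ ∩ pb B φ') := by
      intro φ φ'
      rw [← card_pb (pb B φ ∩ pb B φ') ψ]
      congr 1
      ext z
      simp [mem_pb]
    apply Finset.card_bij (fun p _ => (ψ.trans p.1, ψ.trans p.2))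
    · rintro ⟨φ, φ'⟩ h
      simp only [Finset.mem_filter, Finset.mem_univ, true_and] at h ⊢
      rw [hov]
      simpa [hψ] using h
    · rintro ⟨φ, φ'⟩ _ ⟨χ, χ'⟩ _ h
      simp only [Prod.mk.injEq] at h
      ext z
      · have := congrArg (fun f : G ≃g G => f (ψ.symm z)) h.1
        simpa using this
      · have := congrArg (fun f : G ≃g G => f (ψ.symm z)) h.2
        simpa using this
    · rintro ⟨φ, φ'⟩ h
      have e : ∀ φ : G ≃g G, ψ.trans (ψ.symm.trans φ) = φ := by intro φ; ext x; simp
      refine ⟨(ψ.symm.trans φ, ψ.symm.trans φ'), ?_, by simp [e]⟩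
      simp only [Finset.mem_filter, Finset.mem_univ, true_and] at h ⊢
      have h2 := hov (ψ.symm.trans φ) (ψ.symm.trans φ')
      rw [e, e] at h2
      rw [← h2]
      have : ψ.symm x = y := by rw [← hψ]; simp
      simpa [this] using h
  -- a good vertex
  choose ι hι using hcov
  have hιu : ∀ x i, x ∈ A i ↔ ι x = i := by
    intro x i
    constructor
    · intro h
      by_contra h'
      exact Finset.disjoint_left.1 (hdisj _ _ h') (hι x) h
    · rintro rfl; exact hι x
  have hgood : ∃ x, 19 * k ≤ 21 * Q x (ι x) := by
    by_contra hno
    push Not at hno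
    have h1 : ∑ x : V, 21 * Q x (ι x) < ∑ x : V, 19 * k :=
      Finset.sum_lt_sum_of_nonempty ⟨v0, Finset.mem_univ _⟩ (fun x _ => hno x)
    have h2 : ∑ x : V, Q x (ι x) = ∑ φ : G ≃g G, #(A (I φ) ∩ pb B φ) := by
      simp only [Q, Finset.card_filter]
      rw [Finset.sum_comm]
      refine Finset.sum_congr rfl (fun φ _ => ?_)
      rw [← Finset.card_filter]
      congr 1
      ext x
      simp [mem_pb, hιu, and_comm, eq_comm]
    have h3 : ∑ φ : G ≃g G, 19 * #B ≤ ∑ φ : G ≃g G, 21 * #(A (I φ) ∩ pb B φ) :=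
      Finset.sum_le_sum (fun φ _ => by have := hint φ; have := hmin (I φ); omega)
    rw [← Finset.mul_sum, h2, Finset.mul_sum] at h1
    simp only [Finset.sum_const, Finset.card_univ, smul_eq_mul] at h1 h3
    change F * _ ≤ _ at h3
    change _ < N * _ at h1
    nlinarith
  obtain ⟨xg, hxg⟩ := hgood
  have hClow : ∀ x, 361 * (k * k) ≤ 441 * C x := by
    intro x
    rw [hCconst x xg, hCQ]
    have := Finset.single_le_sum (f := fun i => Q xg i * Q xg i) (fun i _ => Nat.zero_le _)
      (Finset.mem_univ (ι xg))
    nlinarith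
  have hbig : ∀ x, ∃ i, 361 * k ≤ 441 * Q x i := by
    intro x
    by_contra hno
    push Not at hno
    have h1 := hClow x
    rw [hCQ, Finset.mul_sum] at h1
    have hpos : ∃ i ∈ (univ : Finset (Fin n)), Q x i ≠ 0 := by
      apply Finset.exists_ne_zero_of_sum_ne_zero
      rw [hQsum]; omega
    have h2 : ∑ i, 441 * (Q x i * Q x i) < ∑ i, 361 * k * Q x i := by
      apply Finset.sum_lt_sum
      · intro i _
        have := hno i
        nlinarith [Nat.zero_le (Q x i)]
      · obtain ⟨i, hi, h0⟩ := hpos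
        refine ⟨i, hi, ?_⟩
        have := hno i
        have h0 := Nat.pos_of_ne_zero h0
        nlinarith
    rw [← Finset.mul_sum univ (fun i => Q x i), hQsum] at h2
    nlinarith
  have hstep : ∀ x y i, G.Adj x y → 361 * k ≤ 441 * Q x i → 361 * k ≤ 441 * Q y i := by
    intro x y i hxy hx
    obtain ⟨i', hi'⟩ := hbig y
    by_cases hii : i = i'
    · rw [hii]; exact hi'
    exfalso
    have h1 : Q x i ≤ Q y i + tt G B x y := by
      simp only [Q, tt]
      refine le_trans (Finset.card_le_card ?_) (Finset.card_union_le _ _)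
      intro φ
      simp only [Finset.mem_filter, Finset.mem_univ, true_and, Finset.mem_union]
      tauto
    have h2 : Q y i + Q y i' ≤ k := by
      rw [← hQsum y, ← Finset.sum_pair hii]
      exact Finset.sum_le_sum_of_subset (Finset.subset_univ _)
    have h3 := ht x y hxy
    omega
  obtain ⟨i, hi⟩ := hbig v0
  have hall : ∀ x, 361 * k ≤ 441 * Q x i := by
    intro x
    have hw : ∀ (u v : V), G.Walk u v → 361 * k ≤ 441 * Q u i → 361 * k ≤ 441 * Q v i := by
      intro u v w
      induction w with
      | nil => exact id
      | cons h _ ih => exact fun h' => ih (hstep _ _ i h h')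
    obtain ⟨w⟩ := hconn.preconnected v0 x
    exact hw v0 x w hi
  set P := #(univ.filter (fun φ : G ≃g G => I φ = i)) with hP
  have hP1 : 361 * F ≤ 441 * P := by
    have h1 : ∑ x : V, 361 * k ≤ ∑ x : V, 441 * Q x i := Finset.sum_le_sum (fun x _ => hall x)
    have h2 : ∑ x : V, Q x i = P * #B := by
      have : ∑ x : V, Q x i = ∑ φ ∈ univ.filter (fun φ : G ≃g G => I φ = i), #(pb B φ) := by
        simp only [Q, pb, Finset.card_filter, Finset.sum_filter]
        rw [Finset.sum_comm]
        refine Finset.sum_congr rfl (fun φ _ => ?_)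
        by_cases h : I φ = i <;> simp [h]
      rw [this, Finset.sum_congr rfl (fun φ _ => card_pb B φ)]; simp [P]
    rw [← Finset.mul_sum univ (fun x => Q x i), h2] at h1
    simp only [Finset.sum_const, Finset.card_univ, smul_eq_mul] at h1
    change N * _ ≤ _ at h1
    have : (361 * F) * #B ≤ (441 * P) * #B := by nlinarith
    exact Nat.le_of_mul_le_mul_right this hne
  have hP2 : 19 * P ≤ 21 * k := by
    have h1 : ∑ x ∈ A i, kk G B x = ∑ φ : G ≃g G, #(A i ∩ pb B φ) := by
      simp only [kk, Finset.card_filter]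
      rw [Finset.sum_comm]
      refine Finset.sum_congr rfl (fun φ _ => ?_)
      rw [← Finset.card_filter]
      congr 1
      ext x
      simp [mem_pb]
    rw [Finset.sum_congr rfl (fun x _ => hkx x)] at h1
    have h2 : ∑ φ ∈ univ.filter (fun φ : G ≃g G => I φ = i), 19 * #(A i) ≤
        ∑ φ ∈ univ.filter (fun φ : G ≃g G => I φ = i), 21 * #(A i ∩ pb B φ) := by
      refine Finset.sum_le_sum (fun φ h => ?_)
      have := hint φ
      rw [Finset.mem_filter] at h
      rwa [h.2] at this
    have h3 : ∑ φ ∈ univ.filter (fun φ : G ≃g G => I φ = i), 21 * #(A i ∩ pb B φ) ≤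
        ∑ φ : G ≃g G, 21 * #(A i ∩ pb B φ) :=
      Finset.sum_le_sum_of_subset (Finset.subset_univ _)
    rw [← Finset.mul_sum univ, ← h1] at h3
    simp only [Finset.sum_const, smul_eq_mul] at h2 h3
    rw [← hP] at h2
    have h4 : 0 < #(A i) := lt_of_lt_of_le hne (hmin i)
    have : (19 * P) * #(A i) ≤ (21 * k) * #(A i) := by nlinarith
    exact Nat.le_of_mul_le_mul_right this h4
  have hk2 : 2 * k ≤ F := by
    have : N * (2 * k) ≤ N * F := by nlinarith
    exact Nat.le_of_mul_le_mul_left this hNpos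
  omega

lemma ncard_edgeBdry (B : Set V) : (edgeBdry G B).ncard = #(bd G B.toFinset) := by
  rw [← Set.ncard_coe_finset]
  have : edgeBdry G B = (fun p : V × V => s(p.1, p.2)) '' (bd G B.toFinset : Set (V × V)) := by
    ext e
    simp only [edgeBdry, Set.mem_ofPred_eq, Set.mem_image, bd, Finset.coe_filter, Prod.exists,
      Finset.mem_univ, true_and, Set.mem_toFinset]
    constructor
    · rintro ⟨he, u, v, rfl, hu, hv⟩
      exact ⟨u, v, ⟨he, hu, hv⟩, rfl⟩
    · rintro ⟨u, v, ⟨he, hu, hv⟩, rfl⟩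
      exact ⟨he, u, v, rfl, hu, hv⟩
  rw [this, Set.ncard_image_of_injOn]
  rintro ⟨x, y⟩ h ⟨z, w⟩ h' e
  simp only [bd, Finset.coe_filter, Finset.mem_univ, true_and, Set.mem_toFinset,
    Set.mem_ofPred_eq] at h h'
  simp only [Sym2.eq_iff] at e
  rcases e with ⟨rfl, rfl⟩ | ⟨rfl, rfl⟩
  · rfl
  · exact absurd h'.2.1 h.2.2

lemma bd_le (B : Finset V) (d : ℕ) (hd : ∀ x, G.degree x = d) : #(bd G B) ≤ d * #B := by
  have : bd G B ⊆ B.biUnion (fun x => (G.neighborFinset x).image (fun y => (x, y))) := by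
    rintro ⟨x, y⟩ h
    simp only [bd, Finset.mem_filter] at h
    simp only [Finset.mem_biUnion, Finset.mem_image]
    exact ⟨x, h.2.2.1, y, by simpa using h.2.1, rfl⟩
  refine (Finset.card_le_card this).trans ?_
  rw [mul_comm]
  refine Finset.card_biUnion_le_card_mul _ _ _ (fun x _ => ?_)
  refine Finset.card_image_le.trans ?_
  rw [G.card_neighborFinset_eq_degree, hd]

lemma exists_part (n : ℕ) (hn : 0 < n) (hc : n ≤ Fintype.card V) :
    ∃ A : Fin n → Set V, IsNPartition n A := by
  have : Nonempty (Fin n ↪ V) := by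
    apply Function.Embedding.nonempty_of_card_le; simpa using hc
  obtain ⟨e⟩ := this
  haveI : Nonempty (Fin n) := ⟨⟨0, hn⟩⟩
  have hs := Function.leftInverse_invFun e.injective
  refine ⟨fun i => Function.invFun e ⁻¹' {i}, fun i => ⟨e i, hs i⟩, ?_, ?_⟩
  · intro i j hij
    rw [Set.disjoint_left]
    intro x hx hx'
    exact hij (hx.symm.trans hx')
  · ext x; simp

lemma ratio_nonneg {n : ℕ} (A : Fin n → Set V) : 0 ≤ edgeRatioMax G A :=
  Real.iSup_nonneg (fun i => by positivity)

lemma multiH_le {n : ℕ} (hn : 0 < n) (A : Fin n → Set V) (hA : IsNPartition n A) (c : ℝ)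
    (h : ∀ i, ((edgeBdry G (A i)).ncard : ℝ) ≤ c * ((A i).ncard : ℝ)) : multiH G n ≤ c := by
  haveI : Nonempty (Fin n) := ⟨⟨0, hn⟩⟩
  have h1 : multiH G n ≤ edgeRatioMax G A := by
    apply csInf_le
    · refine ⟨0, ?_⟩
      rintro r ⟨A, _, rfl⟩
      exact ratio_nonneg G A
    · exact ⟨A, hA, rfl⟩
  refine h1.trans (ciSup_le (fun i => ?_))
  have : 0 < (A i).ncard := (Set.ncard_pos (Set.toFinite _)).2 (hA.1 i)
  rw [div_le_iff₀ (by exact_mod_cast this)]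
  exact h i

lemma le_ratio {n : ℕ} (A : Fin n → Set V) (hA : IsNPartition n A) (i : Fin n) :
    ((edgeBdry G (A i)).ncard : ℝ) ≤ edgeRatioMax G A * ((A i).ncard : ℝ) := by
  have : 0 < (A i).ncard := (Set.ncard_pos (Set.toFinite _)).2 (hA.1 i)
  rw [← div_le_iff₀ (by exact_mod_cast this)]
  exact le_ciSup (f := fun i => ((edgeBdry G (A i)).ncard : ℝ) / ((A i).ncard : ℝ))
    (Set.finite_range _).bddAbove i

lemma degree_const (hvt : VertexTransitive G) (x y : V) : G.degree x = G.degree y := by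
  obtain ⟨ψ, rfl⟩ := hvt x y
  exact (ψ.degree_eq x).symm

lemma main_part (hconn : G.Connected) (hvt : VertexTransitive G) (het : EdgeTransitive G)
    (n : ℕ) (hn : 2 ≤ n) (hcard : n + 1 ≤ Fintype.card V) (A : Fin n → Set V)
    (hA : IsNPartition n A) : multiH G (n + 1) ≤ 21 * edgeRatioMax G A := by
  set h := edgeRatioMax G A with hh
  have h0 : 0 ≤ h := ratio_nonneg G A
  obtain ⟨v0⟩ := hconn.nonempty
  set d := G.degree v0 with hd
  have hdx : ∀ x, G.degree x = d := fun x => degree_const G hvt x v0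
  by_cases hdh : (d : ℝ) ≤ 21 * h
  · obtain ⟨A', hA'⟩ := exists_part (V := V) (n + 1) (by omega) hcard
    refine (multiH_le G (by omega) A' hA' d (fun i => ?_)).trans hdh
    rw [ncard_edgeBdry, Set.ncard_eq_toFinset_card' (A' i)]
    exact_mod_cast bd_le G _ d hdx
  push Not at hdh
  have hd0 : 0 < d := by
    have : (0 : ℝ) < d := by linarith
    exact_mod_cast this
  haveI : Nonempty (Fin n) := ⟨⟨0, by omega⟩⟩
  let A' : Fin n → Finset V := fun i => (A i).toFinset
  have hcA : ∀ i, (A i).ncard = #(A' i) := fun i => Set.ncard_eq_toFinset_card' (A i)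
  obtain ⟨j, hj⟩ := Finite.exists_min (fun i => #(A' i))
  have hdisj : ∀ i j, i ≠ j → Disjoint (A' i) (A' j) := by
    intro i j hij
    simpa [A'] using hA.2.1 i j hij
  have hcov : ∀ x, ∃ i, x ∈ A' i := by
    intro x
    have : x ∈ ⋃ i, A i := by rw [hA.2.2]; trivial
    simpa [A'] using this
  have hpos : ∀ i, 0 < #(A' i) := by
    intro i
    rw [← hcA]; exact (Set.ncard_pos (Set.toFinite _)).2 (hA.1 i)
  have hhalf : 2 * #(A' j) ≤ Fintype.card V := by
    haveI : Nontrivial (Fin n) := Fin.nontrivial_iff_two_le.2 hn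
    obtain ⟨i, hi⟩ := exists_ne j
    have := Finset.card_le_univ (A' i ∪ A' j)
    rw [Finset.card_union_of_disjoint (hdisj i j hi)] at this
    have := hj i
    omega
  have hbd : ∀ i, (#(bd G (A' i)) : ℝ) ≤ h * #(A' i) := by
    intro i
    have := le_ratio G A hA i
    rwa [ncard_edgeBdry, hcA] at this
  have hb : 21 * #(bd G (A' j)) ≤ d * #(A' j) := by
    have h1 := hbd j
    have h2 : (0 : ℝ) < #(A' j) := by exact_mod_cast hpos j
    have : (21 : ℝ) * #(bd G (A' j)) ≤ d * #(A' j) := by nlinarith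
    exact_mod_cast this
  obtain ⟨φ, hφ⟩ := core G hconn hvt het A' hdisj hcov j hj (hpos j) hhalf d hd0 hdx hb
  set S := pb (A' j) φ with hS
  have hScard : #S = #(A' j) := card_pb _ _
  have hSbd : #(bd G S) = #(bd G (A' j)) := card_bd_pb G _ _
  let T : Fin (n + 1) → Finset V := Fin.cons S (fun i => A' i \ S)
  have hsub : ∀ i, bd G (A' i \ S) ⊆ bd G (A' i) ∪ (bd G S).image Prod.swap := by
    rintro i ⟨x, y⟩ hxy
    simp only [bd, Finset.mem_filter, Finset.mem_univ, true_and, Finset.mem_sdiff,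
      Finset.mem_union, Finset.mem_image, Prod.exists, Prod.swap_prod_mk, Prod.mk.injEq] at hxy ⊢
    by_cases hy : y ∈ A' i
    · right
      exact ⟨y, x, ⟨hxy.1.symm, by tauto, by tauto⟩, rfl, rfl⟩
    · left; tauto
  refine multiH_le G (by omega) (fun i => (T i : Set V)) ⟨?_, ?_, ?_⟩ _ ?_
  · intro i
    rw [Finset.coe_nonempty, ← Finset.card_pos]
    refine Fin.cases ?_ (fun i => ?_) i
    · simpa [T, hScard] using hpos j
    · have h1 := hφ i
      have h2 := hpos i
      simp only [T, Fin.cons_succ]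
      omega
  · intro i i' hii
    rw [Finset.disjoint_coe]
    revert hii
    refine Fin.cases ?_ (fun i => ?_) i <;> refine Fin.cases ?_ (fun i' => ?_) i'
    · simp
    · intro _
      simp only [T, Fin.cons_succ, Fin.cons_zero]
      exact Finset.disjoint_sdiff
    · intro _
      simp only [T, Fin.cons_succ, Fin.cons_zero]
      exact Finset.sdiff_disjoint
    · intro hii
      simp only [T, Fin.cons_succ]
      exact (hdisj i i' (fun e => hii (by rw [e]))).mono Finset.sdiff_subset Finset.sdiff_subset
  · ext x
    simp only [Set.mem_iUnion, Finset.mem_coe, Set.mem_univ, iff_true]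
    by_cases hx : x ∈ S
    · exact ⟨0, by simpa [T] using hx⟩
    · obtain ⟨i, hi⟩ := hcov x
      exact ⟨i.succ, by simpa [T] using ⟨hi, hx⟩⟩
  · intro i
    rw [ncard_edgeBdry, Set.ncard_coe_finset, Finset.toFinset_coe]
    refine Fin.cases ?_ (fun i => ?_) i
    · simp only [T, Fin.cons_zero]
      rw [hSbd, hScard]
      have := hbd j
      have : (0 : ℝ) ≤ h * #(A' j) := by positivity
      linarith
    · simp only [T, Fin.cons_succ]
      have h1 : #(bd G (A' i \ S)) ≤ #(bd G (A' i)) + #(bd G (A' j)) := by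
        refine (Finset.card_le_card (hsub i)).trans ((Finset.card_union_le _ _).trans ?_)
        have := Finset.card_image_le (s := bd G S) (f := Prod.swap)
        omega
      have h1' : (#(bd G (A' i \ S)) : ℝ) ≤ #(bd G (A' i)) + #(bd G (A' j)) := by exact_mod_cast h1
      have h2 : (2 : ℝ) * #(A' i) ≤ 21 * #(A' i \ S) := by exact_mod_cast hφ i
      have h3 : (#(A' j) : ℝ) ≤ #(A' i) := by exact_mod_cast hj i
      have h4 := hbd i
      have h5 := hbd j
      nlinarith

end core

theorem h_gap_vertex_edge_transitive {V : Type*} [Fintype V] (G : SimpleGraph V)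
    (hconn : G.Connected) (hvt : VertexTransitive G) (het : EdgeTransitive G)
    (n : ℕ) (hn : 2 ≤ n) (hcard : n + 1 ≤ Fintype.card V) :
    multiH G (n + 1) ≤ (10 * n + 1) * multiH G n := by
  classical
  have hne : {r | ∃ A : Fin n → Set V, IsNPartition n A ∧ r = edgeRatioMax G A}.Nonempty := by
    obtain ⟨A, hA⟩ := exists_part (V := V) n (by omega) (by omega)
    exact ⟨_, A, hA, rfl⟩
  have h0 : 0 ≤ multiH G n := by
    apply le_csInf hne
    rintro r ⟨A, _, rfl⟩
    exact ratio_nonneg G A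
  have h1 : multiH G (n + 1) / 21 ≤ multiH G n := by
    apply le_csInf hne
    rintro r ⟨A, hA, rfl⟩
    have := main_part G hconn hvt het n hn hcard A hA
    linarith
  have h2 : (2 : ℝ) ≤ n := by exact_mod_cast hn
  nlinarith

end Multiway
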